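/- For every n ≥ 2, the n-dimensional ℝ-algebra with basis η₁,…,η_n and relations η₁⋆η₁ = −η₁; η₁⋆η_s = ((s−1−n)/n)η_s for s = 2,…,n; η_s⋆η_n = η_{s−1} for s = 2,…,n−1; η_n⋆η_s = (s−1)η_{s−1} for s = 2,…,n−1; η_n⋆η_n = η_{n−1} (all other products zero) is a left-symmetric algebra; its right-adjoint operator is a linear Nijenhuis operator whose characteristic polynomial coefficients are (up to sign) σ₁ = x₁, σ_i = x_i x_n^{i−1} for i = 2,…,n−1, σ_n = (1/n)x_n^n, and these are algebraically independent over ℝ, so the algebra is differentially non-degenerate. -/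

import Mathlib

open Matrix

/-- Components `N^i_{jk}` of the Nijenhuis torsion of a matrix-valued operator
field `L` on `ℝⁿ` (with `L x i j = L^i_j(x)`). -/
noncomputable def nijTorsion {n : ℕ} (L : (Fin n → ℝ) → Matrix (Fin n) (Fin n) ℝ)
    (x : Fin n → ℝ) (i j k : Fin n) : ℝ :=
  ∑ s : Fin n,
    (L x s j * fderiv ℝ (fun y => L y i k) x (Pi.single s 1)
      - L x s k * fderiv ℝ (fun y => L y i j) x (Pi.single s 1)
      - L x i s * fderiv ℝ (fun y => L y s k) x (Pi.single j 1)
      + L x i s * fderiv ℝ (fun y => L y s j) x (Pi.single k 1))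

/-- `L` is a Nijenhuis operator: its Nijenhuis torsion vanishes identically. -/
def IsNijenhuis {n : ℕ} (L : (Fin n → ℝ) → Matrix (Fin n) (Fin n) ℝ) : Prop :=
  ∀ x i j k, nijTorsion L x i j k = 0

/-- Bilinear product on `ℝⁿ` with structure constants `a i j k`
(`ηᵢ ⋆ ηⱼ = ∑ₖ a i j k • ηₖ`). -/
def mulSC {n : ℕ} (a : Fin n → Fin n → Fin n → ℝ) (ξ η : Fin n → ℝ) : Fin n → ℝ :=
  fun k => ∑ i : Fin n, ∑ j : Fin n, a i j k * ξ i * η j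

/-- Left-symmetry: the associator is symmetric in its first two arguments. -/
def IsLSA {n : ℕ} (a : Fin n → Fin n → Fin n → ℝ) : Prop :=
  ∀ ξ η ζ : Fin n → ℝ,
    mulSC a (mulSC a ξ η) ζ - mulSC a ξ (mulSC a η ζ)
      = mulSC a (mulSC a η ξ) ζ - mulSC a η (mulSC a ξ ζ)

/-- The right-adjoint operator field of the algebra with structure constants `a`:
`(R x) k i = ∑ j, a i j k * x j`, i.e. `(R x).mulVec ξ = ξ ⋆ x`. -/
def rightAdj {n : ℕ} (a : Fin n → Fin n → Fin n → ℝ) (x : Fin n → ℝ) :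
    Matrix (Fin n) (Fin n) ℝ :=
  Matrix.of fun k i => ∑ j : Fin n, a i j k * x j

/-- `charCoeff L i` is the coefficient `σ_{i+1}` of `t^(n-1-i)` in the characteristic
polynomial `χ_{L(x)}(t) = tⁿ + σ₁(x) tⁿ⁻¹ + ⋯ + σₙ(x)` of `L(x)`. -/
noncomputable def charCoeff {n : ℕ} (L : (Fin n → ℝ) → Matrix (Fin n) (Fin n) ℝ)
    (i : Fin n) : (Fin n → ℝ) → ℝ :=
  fun x => (L x).charpoly.coeff (n - 1 - (i : ℕ))

/-- A (structure-constant) algebra is differentially non-degenerate if the coefficients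
of the characteristic polynomial of its right-adjoint operator are algebraically
independent over `ℝ` (as elements of the algebra of real-valued functions). -/
def DiffNonDeg {n : ℕ} (a : Fin n → Fin n → Fin n → ℝ) : Prop :=
  AlgebraicIndependent ℝ (charCoeff (rightAdj a))

/-- Isomorphism of the algebras on `ℝⁿ` with structure constants `a` and `b`. -/
def AlgIsoSC {n : ℕ} (a b : Fin n → Fin n → Fin n → ℝ) : Prop :=
  ∃ φ : (Fin n → ℝ) ≃ₗ[ℝ] (Fin n → ℝ),
    ∀ ξ η : Fin n → ℝ, φ (mulSC a ξ η) = mulSC b (φ ξ) (φ η)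

/-- Jacobi matrix of a family of functions `σ` on `ℝⁿ`: `J i j = ∂σᵢ/∂xⱼ`. -/
noncomputable def jacobiMat {n : ℕ} (σ : Fin n → (Fin n → ℝ) → ℝ) (x : Fin n → ℝ) :
    Matrix (Fin n) (Fin n) ℝ :=
  Matrix.of fun i j => fderiv ℝ (σ i) x (Pi.single j 1)

/-- Companion-type matrix with first column `(-s 0, …, -s (n-1))ᵀ`, ones on the
superdiagonal and zeros elsewhere. -/
def companionS {n : ℕ} (s : Fin n → ℝ) : Matrix (Fin n) (Fin n) ℝ :=
  Matrix.of fun i j => if (j : ℕ) = 0 then -s i else if (j : ℕ) = (i : ℕ) + 1 then 1 else 0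

/-- Structure constants (0-indexed) of the `n`-dimensional generalisation of `L₁`:
`η₁⋆η₁ = -η₁`, `η₁⋆η_s = ((s-1-n)/n) η_s`, `η_s⋆η_n = η_{s-1}`,
`η_n⋆η_s = (s-1) η_{s-1}` (for `2 ≤ s ≤ n-1`), `η_n⋆η_n = η_{n-1}`. -/
noncomputable def genA1 (n : ℕ) : Fin n → Fin n → Fin n → ℝ := fun i j k =>
  if (i : ℕ) = 0 then (if k = j then ((j : ℝ) - n) / n else 0)
  else if (j : ℕ) = n - 1 then
    (if (i : ℕ) = n - 1 then (if (k : ℕ) = n - 2 then 1 else 0)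
     else (if (k : ℕ) + 1 = (i : ℕ) then 1 else 0))
  else if (i : ℕ) = n - 1 then
    (if 1 ≤ (j : ℕ) ∧ (j : ℕ) ≤ n - 2 ∧ (k : ℕ) + 1 = (j : ℕ) then (j : ℝ) else 0)
  else 0

/-- The claimed coefficients (0-indexed): `σ₁ = x₁`, `σ_i = x_i x_n^{i-1}`
(`2 ≤ i ≤ n-1`), `σ_n = (1/n) x_n^n`. -/
noncomputable def genSigma1 {n : ℕ} (i : Fin n) (x : Fin n → ℝ) : ℝ :=
  if (i : ℕ) = 0 then x i
  else if (i : ℕ) = n - 1 then (1 / (n : ℝ)) * x i ^ n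
  else x i * x ⟨n - 1, Nat.sub_lt i.pos Nat.one_pos⟩ ^ (i : ℕ)

theorem fderiv_rightAdj_apply {n : ℕ} (a : Fin n → Fin n → Fin n → ℝ) (x v : Fin n → ℝ)
    (k i : Fin n) :
    fderiv ℝ (fun y => rightAdj a y k i) x v = ∑ j, a i j k * v j := by
  let f : (Fin n → ℝ) →L[ℝ] ℝ := ∑ j, a i j k • ContinuousLinearMap.proj j
  have hf : (fun y => rightAdj a y k i) = f := by
    ext y
    simp [f, rightAdj]
  rw [hf, f.fderiv]
  simp [f]

theorem mulSC_eq_mulVec {n : ℕ} (a : Fin n → Fin n → Fin n → ℝ) (ξ η : Fin n → ℝ) :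
    mulSC a ξ η = rightAdj a η *ᵥ ξ := by
  ext k
  simp only [mulSC, rightAdj, mulVec, dotProduct, of_apply, Finset.sum_mul]
  exact Finset.sum_congr rfl fun i _ => Finset.sum_congr rfl fun j _ => by ring

theorem rightAdj_eq_mulSC_single {n : ℕ} (a : Fin n → Fin n → Fin n → ℝ) (x : Fin n → ℝ)
    (k i : Fin n) : rightAdj a x k i = mulSC a (Pi.single i 1) x k := by
  rw [mulSC_eq_mulVec, mulVec_single_one, col_apply]

/-- The right-adjoint operator of a left-symmetric algebra is Nijenhuis. -/
theorem IsLSA.isNijenhuis_rightAdj {n : ℕ} {a : Fin n → Fin n → Fin n → ℝ} (ha : IsLSA a) :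
    IsNijenhuis (rightAdj a) := by
  intro x i j k
  have h := congrFun (ha (Pi.single j 1) (Pi.single k 1) x) i
  have key : ∀ p q : Fin n, mulSC a (Pi.single p 1) (mulSC a (Pi.single q 1) x) i
      = ∑ s, rightAdj a x s q * a p s i := by
    intro p q
    rw [← rightAdj_eq_mulSC_single a (mulSC a (Pi.single q 1) x)]
    simp only [rightAdj, of_apply (f := fun k i => ∑ j, a i j k * mulSC a (Pi.single q 1) x j)]
    exact Finset.sum_congr rfl fun s _ => by
      rw [← rightAdj_eq_mulSC_single a x, mul_comm, rightAdj, of_apply]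
  have key' : ∀ p q : Fin n, mulSC a (mulSC a (Pi.single p 1) (Pi.single q 1)) x i
      = ∑ s, rightAdj a x i s * a p q s := by
    intro p q
    rw [mulSC_eq_mulVec a _ x, mulVec, dotProduct]
    refine Finset.sum_congr rfl fun s _ => ?_
    rw [← rightAdj_eq_mulSC_single a]
    simp [rightAdj, Pi.single_apply]
  simp only [Pi.sub_apply, key, key'] at h
  simp only [nijTorsion, fderiv_rightAdj_apply, Pi.single_apply, mul_ite, mul_one, mul_zero,
    Finset.sum_ite_eq', Finset.mem_univ, if_true, Finset.sum_add_distrib, Finset.sum_sub_distrib]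
  linarith

/-- Extension of a vector by zero to a sequence. -/
def zeroExtend {n : ℕ} (x : Fin n → ℝ) (k : ℕ) : ℝ := if h : k < n then x ⟨k, h⟩ else 0

theorem zeroExtend_val {n : ℕ} (x : Fin n → ℝ) (k : Fin n) : zeroExtend x k = x k := by
  simp [zeroExtend]

theorem zeroExtend_of_le {n : ℕ} (x : Fin n → ℝ) {k : ℕ} (hk : n ≤ k) : zeroExtend x k = 0 := by
  simp [zeroExtend, hk]

theorem sum_ite_val_mul {n : ℕ} (x : Fin n → ℝ) (p : ℕ) (c : ℝ) :
    ∑ i : Fin n, (if (i : ℕ) = p then c else 0) * x i = c * zeroExtend x p := by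
  by_cases h : p < n
  · rw [Finset.sum_eq_single ⟨p, h⟩]
    · simp [zeroExtend, h]
    · intro b _ hb
      rw [if_neg (fun h' => hb (Fin.ext h')), zero_mul]
    · simp
  · rw [zeroExtend_of_le x (not_lt.mp h), mul_zero]
    refine Finset.sum_eq_zero fun j _ => ?_
    rw [if_neg (by omega), zero_mul]

theorem genA1_eq (m : ℕ) (i j k : Fin (m + 2)) :
    genA1 (m + 2) i j k =
      (if j = k then (if (i : ℕ) = 0 then ((k : ℝ) - (m + 2)) / (m + 2) else 0) else 0)
      + (if j = Fin.last (m + 1) then (if (k : ℕ) + 1 = i then 1 else 0) else 0)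
      + (if (j : ℕ) = k + 1 then
          (if (i : ℕ) = m + 1 ∧ (k : ℕ) ≠ m then (k : ℝ) + 1 else 0) else 0) := by
  obtain ⟨i, hi⟩ := i
  obtain ⟨j, hj⟩ := j
  obtain ⟨k, hk⟩ := k
  simp only [genA1, Fin.ext_iff, Fin.val_last, Nat.add_sub_cancel,
    show m + 2 - 1 = m + 1 from rfl]
  split_ifs <;> first | omega | (subst_vars; push_cast; ring)

theorem rightAdj_genA1 (m : ℕ) (x : Fin (m + 2) → ℝ) (k i : Fin (m + 2)) :
    rightAdj (genA1 (m + 2)) x k i =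
      (if (i : ℕ) = 0 then ((k : ℝ) - (m + 2)) / (m + 2) * zeroExtend x k else 0)
      + (if (k : ℕ) + 1 = i then zeroExtend x (m + 1) else 0)
      + (if (i : ℕ) = m + 1 then
          (if (k : ℕ) = m then 0 else ((k : ℝ) + 1) * zeroExtend x (k + 1)) else 0) := by
  have hlast : zeroExtend x (m + 1) = x (Fin.last (m + 1)) := zeroExtend_val x (Fin.last (m + 1))
  simp only [rightAdj, of_apply, genA1_eq, add_mul, Finset.sum_add_distrib, sum_ite_val_mul, hlast,
    zeroExtend_val]
  simp only [ite_mul, zero_mul, one_mul, Finset.sum_ite_eq', Finset.mem_univ, if_true]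
  split_ifs <;> first | omega | ring

theorem zeroExtend_mulSC_genA1 (m : ℕ) (ξ η : Fin (m + 2) → ℝ) (k : ℕ) :
    zeroExtend (mulSC (genA1 (m + 2)) ξ η) k =
      ((k : ℝ) - (m + 2)) / (m + 2) * zeroExtend ξ 0 * zeroExtend η k
      + zeroExtend η (m + 1) * zeroExtend ξ (k + 1)
      + (if k = m then 0 else ((k : ℝ) + 1) * zeroExtend ξ (m + 1) * zeroExtend η (k + 1)) := by
  by_cases hk : k < m + 2
  · rw [zeroExtend, dif_pos hk, mulSC_eq_mulVec]
    simp only [mulVec, dotProduct, rightAdj_genA1, add_mul, Finset.sum_add_distrib,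
      eq_comm (a := k + 1), sum_ite_val_mul]
    split_ifs <;> ring
  · have h := not_lt.mp hk
    rw [zeroExtend_of_le _ h, zeroExtend_of_le _ h, zeroExtend_of_le ξ (h.trans k.le_succ),
      zeroExtend_of_le η (h.trans k.le_succ)]
    simp

theorem isLSA_genA1 (m : ℕ) : IsLSA (genA1 (m + 2)) := by
  intro ξ η ζ
  ext k
  have hm : (m : ℝ) + 2 ≠ 0 := by positivity
  have h0 := zeroExtend_of_le ξ (le_refl (m + 2))
  have h1 := zeroExtend_of_le η (le_refl (m + 2))
  have h2 := zeroExtend_of_le ζ (le_refl (m + 2))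
  have h0' := zeroExtend_of_le ξ (Nat.le_succ (m + 2))
  have h1' := zeroExtend_of_le η (Nat.le_succ (m + 2))
  have h2' := zeroExtend_of_le ζ (Nat.le_succ (m + 2))
  simp only [Pi.sub_apply, ← zeroExtend_val (mulSC _ _ _) k, zeroExtend_mulSC_genA1]
  obtain ⟨k, hk⟩ := k
  simp only [Nat.succ_eq_add_one] at h0' h1' h2'
  rcases (by omega : k = m + 1 ∨ k = m ∨ m = k + 1 ∨ (k ≠ m ∧ k + 1 ≠ m))
    with hk' | hk' | hk' | ⟨hk1, hk2⟩ <;>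
  rcases Nat.eq_zero_or_pos m with hm0 | hm0 <;>
  first
  | omega
  | (simp_all [add_assoc, Nat.pos_iff_ne_zero, eq_comm (a := 0)]
     try field_simp
     try ring)

/-- The polynomial sequence of characteristic coefficients, in zero-extended coordinates. -/
noncomputable def sigmaSeq (m : ℕ) (y : ℕ → ℝ) (k : ℕ) : ℝ :=
  if k = m + 1 then 1 / ((m : ℝ) + 2) * y k ^ (m + 2) else y k * y (m + 1) ^ k

theorem genSigma1_eq_sigmaSeq (m : ℕ) (x : Fin (m + 2) → ℝ) (i : Fin (m + 2)) :
    genSigma1 i x = sigmaSeq m (zeroExtend x) i := by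
  have hlast : zeroExtend x (m + 1) = x (Fin.last (m + 1)) := zeroExtend_val x (Fin.last (m + 1))
  simp only [genSigma1, sigmaSeq, zeroExtend_val, hlast, show m + 2 - 1 = m + 1 from rfl]
  split_ifs with h1 h2 h2
  · omega
  · simp [h1]
  · push_cast; rfl
  · rfl

open Polynomial in
theorem charpoly_rightAdj_genA1 (m : ℕ) (x : Fin (m + 2) → ℝ) :
    (rightAdj (genA1 (m + 2)) x).charpoly =
      X ^ (m + 2) + ∑ k ∈ Finset.range (m + 2),
        C (sigmaSeq m (zeroExtend x) k) * X ^ (m + 1 - k) := by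
  set y := zeroExtend x with hy
  set A := charmatrix (rightAdj (genA1 (m + 2)) x) with hA
  set χ : ℝ[X] := X ^ (m + 2) + ∑ k ∈ Finset.range (m + 2),
        C (sigmaSeq m y k) * X ^ (m + 1 - k) with hχ
  let S : ℝ[X] := ∑ k ∈ Finset.range m,
    C (((k : ℝ) + 1) * y (k + 1) * y (m + 1) ^ k) * X ^ (m - k)
  let w : ℕ → ℝ[X] := fun k => C (y (m + 1) ^ k) * X ^ (m + 1 - k) + if k = m + 1 then S else 0
  have hm : (m : ℝ) + 2 ≠ 0 := by positivity
  have hyn : y (m + 1 + 1) = 0 := zeroExtend_of_le x le_rfl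
  have hAentry : ∀ k i : Fin (m + 2), A k i = (if k = i then X else 0)
      - C (rightAdj (genA1 (m + 2)) x k i) := by
    intro k i
    rw [hA, charmatrix_apply, diagonal_apply]
  have hdiag : ∀ i : Fin (m + 2), ∑ k : Fin (m + 2), w k * (if k = i then X else 0) = w i * X := by
    intro i
    simp
  have hsuper : ∀ i : Fin (m + 2), ∑ k : Fin (m + 2),
      w k * C (if (k : ℕ) + 1 = i then y (m + 1) else 0)
        = if (i : ℕ) = 0 then 0 else w (i - 1) * C (y (m + 1)) := by
    intro i
    split_ifs with hi
    · exact Finset.sum_eq_zero fun k _ => by rw [if_neg (by omega), C_0, mul_zero]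
    · rw [Finset.sum_eq_single ⟨i - 1, by omega⟩]
      · rw [if_pos (Nat.sub_add_cancel (Nat.pos_of_ne_zero hi))]
      · intro k _ hk
        rw [if_neg (fun h => hk (Fin.ext (by simp [← h]))), C_0, mul_zero]
      · simp
  have hlast : ∑ k : Fin (m + 2),
      w k * C (if (k : ℕ) = m then 0 else ((k : ℝ) + 1) * y (k + 1)) = S * X := by
    rw [Fin.sum_univ_eq_sum_range
      (fun k => w k * C (if k = m then 0 else ((k : ℝ) + 1) * y (k + 1))),
      Finset.sum_range_succ, Finset.sum_range_succ, hyn, Finset.sum_mul, if_pos rfl]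
    simp only [C_0, mul_zero, add_zero, ite_self]
    refine Finset.sum_congr rfl fun k hk => ?_
    rw [Finset.mem_range] at hk
    simp only [w, if_neg hk.ne, if_neg (show k ≠ m + 1 by omega),
      show m + 1 - k = m - k + 1 by omega, pow_succ X, C_mul]
    ring
  have hfirst : ∑ k : Fin (m + 2),
      w k * C (((k : ℝ) - (m + 2)) / (m + 2) * y k) = X ^ (m + 2) - χ := by
    have hterm : ∀ k ∈ Finset.range m,
        w (k + 1) * C ((((k + 1 : ℕ) : ℝ) - (m + 2)) / (m + 2) * y (k + 1))
          = C (((k : ℝ) + 1) * y (k + 1) * y (m + 1) ^ k) * X ^ (m - k)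
              * C (1 / ((m : ℝ) + 2) * y (m + 1))
            - C (sigmaSeq m y (k + 1)) * X ^ (m + 1 - (k + 1)) := by
      intro k hk
      have hk' : k + 1 ≠ m + 1 := by
        rw [Finset.mem_range] at hk
        omega
      have hC : y (m + 1) ^ (k + 1) * ((((k + 1 : ℕ) : ℝ) - (m + 2)) / (m + 2) * y (k + 1))
          = ((k : ℝ) + 1) * y (k + 1) * y (m + 1) ^ k * (1 / ((m : ℝ) + 2) * y (m + 1))
            - y (k + 1) * y (m + 1) ^ (k + 1) := by
        push_cast
        field_simp
        ring
      simp only [w, sigmaSeq, if_neg hk', add_zero, Nat.add_sub_add_right]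
      rw [mul_right_comm, ← C_mul, hC, C_sub, sub_mul, mul_right_comm _ (X ^ _), ← C_mul]
    rw [Fin.sum_univ_eq_sum_range (fun k => w k * C (((k : ℝ) - (m + 2)) / (m + 2) * y k)), hχ,
      Finset.sum_range_succ, Finset.sum_range_succ', Finset.sum_congr rfl hterm,
      Finset.sum_sub_distrib, ← Finset.sum_mul, Finset.sum_range_succ _ (m + 1),
      Finset.sum_range_succ' _ m]
    have hC0 : ((((0 : ℕ) : ℝ) - (m + 2)) / (m + 2) * y 0) = - y 0 := by
      push_cast
      field_simp
      ring
    have hC1 : ((((m + 1 : ℕ) : ℝ) - (m + 2)) / (m + 2) * y (m + 1))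
        = - (1 / ((m : ℝ) + 2) * y (m + 1)) := by
      push_cast
      ring
    rw [hC0, hC1]
    simp [w, sigmaSeq, S, pow_succ]
    ring
  have hrow : ∑ k : Fin (m + 2), w k • A k = Pi.single 0 χ := by
    ext1 i
    simp only [Finset.sum_apply, Pi.smul_apply, smul_eq_mul, hAentry, rightAdj_genA1, C_add,
      mul_add, mul_sub, Finset.sum_add_distrib, Finset.sum_sub_distrib, hdiag, ← hy]
    rw [hsuper]
    by_cases hi0 : i = 0
    · subst hi0
      simp only [Fin.val_zero, if_true, hfirst]
      simp [w]
      ring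
    · have hi0' : (i : ℕ) ≠ 0 := fun h => hi0 (Fin.ext h)
      obtain ⟨j, hj⟩ := Nat.exists_eq_succ_of_ne_zero hi0'
      have hjm : j ≤ m := by omega
      rw [Pi.single_eq_of_ne hi0]
      simp only [if_neg hi0', C_0, mul_zero, Finset.sum_const_zero]
      by_cases hi1 : (i : ℕ) = m + 1
      · simp only [hi1, if_true, hlast, w]
        simp [pow_succ]
        ring
      · have h1 : j ≠ m + 1 := by omega
        have h2 : j + 1 ≠ m + 1 := by omega
        simp only [hj, Nat.succ_eq_add_one, Nat.add_sub_cancel, w, if_neg h1, if_neg h2,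
          show m + 1 - j = m + 1 - (j + 1) + 1 by omega, pow_succ, C_mul]
        simp
        ring
  have hminor : (A.submatrix Fin.succ (Fin.succAbove 0)).det = X ^ (m + 1) := by
    rw [det_of_isUpperTriangular]
    · rw [Finset.prod_eq_pow_card (b := X), Finset.card_univ, Fintype.card_fin]
      intro k _
      simp [hAentry, rightAdj_genA1, ← hy]
      intro h
      simp [h, hyn]
    · intro i j hij
      have hij' : (j : ℕ) < i := hij
      have hne : i ≠ j := fun h => by simp [h] at hij'
      have h1 : (j : ℕ) ≠ m := by omega
      have h2 : (i : ℕ) + 1 ≠ j := by omega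
      simp [hAentry, rightAdj_genA1, hne, h1, h2]
  have hdet := det_updateRow_sum A 0 (fun k => w k)
  rw [hrow, det_succ_row_zero, Fin.sum_univ_succ] at hdet
  have hXne : (X : ℝ[X]) ^ (m + 1) ≠ 0 := pow_ne_zero _ X_ne_zero
  have hsub : (A.updateRow 0 (Pi.single 0 χ)).submatrix Fin.succ (Fin.succAbove 0)
      = A.submatrix Fin.succ (Fin.succAbove 0) := by
    ext i j : 2
    simp [updateRow_apply]
  rw [hsub, hminor] at hdet
  refine mul_left_cancel₀ hXne ?_
  rw [charpoly, ← hA]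
  simpa [w, mul_comm] using hdet.symm

theorem charCoeff_rightAdj_genA1 (m : ℕ) (i : Fin (m + 2)) (x : Fin (m + 2) → ℝ) :
    charCoeff (rightAdj (genA1 (m + 2))) i x = genSigma1 i x := by
  rw [charCoeff, charpoly_rightAdj_genA1, genSigma1_eq_sigmaSeq, Polynomial.coeff_add,
    Polynomial.coeff_X_pow, if_neg (by omega), zero_add, Polynomial.finsetSum_coeff,
    Finset.sum_eq_single (i : ℕ)]
  · simp
  · intro b hb hbi
    rw [Finset.mem_range] at hb
    rw [Polynomial.coeff_C_mul, Polynomial.coeff_X_pow, if_neg (by omega), mul_zero]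
  · simp

theorem exists_genSigma1_eq (m : ℕ) (y : Fin (m + 2) → ℝ) (hy : ∀ i, 0 < y i) :
    ∃ x : Fin (m + 2) → ℝ, ∀ i, genSigma1 i x = y i := by
  have hm : (0 : ℝ) < m + 2 := by positivity
  set r : ℝ := ((m + 2) * y (Fin.last (m + 1))) ^ (((m + 2 : ℕ) : ℝ)⁻¹) with hr
  have hpos : 0 < (m + 2) * y (Fin.last (m + 1)) := mul_pos hm (hy _)
  have hr0 : 0 < r := Real.rpow_pos_of_pos hpos _
  have hrpow : r ^ (m + 2) = (m + 2) * y (Fin.last (m + 1)) :=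
    Real.rpow_inv_natCast_pow hpos.le (by omega)
  refine ⟨fun i => if i = Fin.last (m + 1) then r else y i / r ^ (i : ℕ), fun i => ?_⟩
  have hlast : ∀ h, (⟨m + 1, h⟩ : Fin (m + 2)) = Fin.last (m + 1) := fun _ => rfl
  have hi : (i : ℕ) = m + 1 ↔ i = Fin.last (m + 1) := by simp [Fin.ext_iff]
  simp only [genSigma1, hlast, show m + 2 - 1 = m + 1 from rfl, hi, if_true]
  split_ifs with h0 h1 h1
  · subst h1; simp at h0
  · simp [h0]
  · rw [hrpow, h1]; push_cast; field_simp
  · field_simp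

theorem algebraicIndependent_genSigma1 (m : ℕ) :
    AlgebraicIndependent ℝ
      (fun i : Fin (m + 2) => (genSigma1 i : (Fin (m + 2) → ℝ) → ℝ)) := by
  rw [algebraicIndependent_iff]
  intro p hp
  refine MvPolynomial.funext_set (fun _ => Set.Ioi (0 : ℝ)) (fun _ => Set.Ioi_infinite 0) ?_
  intro y hy
  obtain ⟨x, hx⟩ := exists_genSigma1_eq m y fun i => hy i (Set.mem_univ i)
  have h := DFunLike.congr_fun
    (MvPolynomial.comp_aeval (fun i : Fin (m + 2) => (genSigma1 i : (Fin (m + 2) → ℝ) → ℝ))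
      (Pi.evalAlgHom ℝ (fun _ : Fin (m + 2) → ℝ => ℝ) x)) p
  simp only [AlgHom.comp_apply, hp, map_zero, Pi.evalAlgHom_apply, hx] at h
  rw [map_zero, ← MvPolynomial.aeval_eq_eval]
  exact h.symm

/-- The `n`-dimensional generalisation of `L₁` is a left-symmetric algebra, its
right-adjoint operator is a (linear) Nijenhuis operator whose characteristic
polynomial coefficients are, up to sign, `σ₁ = x₁`, `σ_i = x_i x_n^{i-1}`,
`σ_n = (1/n) x_n^n`; these are algebraically independent over `ℝ`, so the algebra
is differentially non-degenerate. -/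
theorem stmt17 (n : ℕ) (hn : 2 ≤ n) :
    IsLSA (genA1 n) ∧
    IsNijenhuis (rightAdj (genA1 n)) ∧
    (∃ ε : Fin n → ℝ, (∀ i, ε i = 1 ∨ ε i = -1) ∧
      ∀ (i : Fin n) (x : Fin n → ℝ),
        charCoeff (rightAdj (genA1 n)) i x = ε i * genSigma1 i x) ∧
    AlgebraicIndependent ℝ (fun i : Fin n => (genSigma1 i : (Fin n → ℝ) → ℝ)) ∧
    DiffNonDeg (genA1 n) := by
  obtain ⟨m, rfl⟩ := Nat.exists_eq_add_of_le' hn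
  have hcoeff : charCoeff (rightAdj (genA1 (m + 2)))
      = fun i : Fin (m + 2) => (genSigma1 i : (Fin (m + 2) → ℝ) → ℝ) :=
    funext fun i => funext fun x => charCoeff_rightAdj_genA1 m i x
  refine ⟨isLSA_genA1 m, (isLSA_genA1 m).isNijenhuis_rightAdj,
    ⟨fun _ => 1, fun _ => Or.inl rfl, fun i x => ?_⟩, algebraicIndependent_genSigma1 m, ?_⟩
  · rw [charCoeff_rightAdj_genA1, one_mul]
  · rw [DiffNonDeg, hcoeff]
    exact algebraicIndependent_genSigma1 m
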